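/- For every f ∈ C_c^∞(ℝ, ℂ), the limit λ(f, f) := lim_{ε→0⁺} −(1/π) ∫_ℝ ∫_ℝ conj(f(x))·f(y)·(x − y − iε)^{−2} dx dy exists, is a real number, equals ∫_0^∞ 2k·|f̂(k)|² dk, and in particular is nonnegative; hence the sesquilinear form λ is positive semidefinite on C_c^∞(ℝ, ℂ). -/

import Mathlib

open MeasureTheory Filter

lemma aux_swap (μ : Measure ℝ) [SFinite μ] (u v : ℝ → ℂ) (s : ℝ) (hu : Integrable u)
    (hv : Integrable v μ) :
    ∫ x : ℝ, u x * ∫ k, v k * Complex.exp (Complex.I * s * k * x) ∂μ =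
      ∫ k, v k * (∫ x : ℝ, Complex.exp (Complex.I * s * k * x) * u x) ∂μ := by
  simp_rw [← integral_const_mul]
  rw [integral_integral_swap]
  · refine integral_congr_ae (Eventually.of_forall fun k => integral_congr_ae
      (Eventually.of_forall fun x => ?_))
    simp only; ring
  · have h := (hu.mul_prod hv).mul_bdd (c := 1)
      (g := fun p : ℝ × ℝ => Complex.exp (Complex.I * s * p.2 * p.1))
      (by apply Continuous.aestronglyMeasurable; fun_prop)
      (Eventually.of_forall fun p => by
        rw [show Complex.I * s * p.2 * p.1 = ((s * p.2 * p.1 : ℝ) : ℂ) * Complex.I by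
          push_cast; ring, Complex.norm_exp_ofReal_mul_I])
    refine h.congr (Eventually.of_forall fun p => ?_)
    simp only [Function.uncurry]; ring

lemma aux_int (ε : ℝ) (hε : 0 < ε) :
    IntegrableOn (fun k : ℝ => (k:ℂ) * Complex.exp (-(ε * k))) (Set.Ioi 0) := by
  have h : IntegrableOn (fun k : ℝ => k * Real.exp (-(ε * k))) (Set.Ioi 0) := by
    have := integrableOn_rpow_mul_exp_neg_mul_rpow (p := 1) (s := 1) (b := ε) (by norm_num)
      (by norm_num) hε
    simpa using this
  refine (Integrable.ofReal (𝕜 := ℂ) h).congr (Eventually.of_forall fun k => ?_)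
  simp

lemma aux_gamma (z : ℂ) (hz : 0 < z.re) :
    ∫ k in Set.Ioi (0:ℝ), (k:ℂ) * Complex.exp (-(z * k)) = (z ^ 2)⁻¹ := by
  have hz0 : z ≠ 0 := by rintro rfl; simp at hz
  have hder : ∀ k : ℝ, HasDerivAt
      (fun k : ℝ => -((k:ℂ) * Complex.exp (-(z * k)) * z⁻¹ + Complex.exp (-(z * k)) * (z ^ 2)⁻¹))
      ((k:ℂ) * Complex.exp (-(z * k))) k := by
    intro k
    have h1 : HasDerivAt (fun k : ℝ => (k:ℂ)) 1 k := Complex.ofRealCLM.hasDerivAt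
    have h2 : HasDerivAt (fun k : ℝ => Complex.exp (-(z * k)))
      (Complex.exp (-(z * k)) * (-(z * 1))) k := ((h1.const_mul z).neg).cexp
    have h3 := (((h1.mul h2).mul_const z⁻¹).add (h2.mul_const (z ^ 2)⁻¹)).neg
    refine h3.congr_deriv ?_
    field_simp
    ring
  have hn : ∀ k : ℝ, ‖Complex.exp (-(z * k))‖ = Real.exp (-z.re * k) := by
    intro k
    rw [Complex.norm_exp]
    simp
  have hint : IntegrableOn (fun k : ℝ => (k:ℂ) * Complex.exp (-(z * k))) (Set.Ioi 0) := by
    refine (aux_int z.re hz).norm.mono' (by apply Continuous.aestronglyMeasurable; fun_prop)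
      (Eventually.of_forall fun k => ?_)
    rw [norm_mul, norm_mul, hn, Complex.norm_exp]
    simp
  have t1 : Tendsto (fun k : ℝ => (k:ℂ) * Complex.exp (-(z * k))) atTop (nhds 0) := by
    rw [tendsto_zero_iff_norm_tendsto_zero]
    have := (tendsto_rpow_mul_exp_neg_mul_atTop_nhds_zero 1 z.re hz).norm
    simpa [hn] using this
  have t2 : Tendsto (fun k : ℝ => Complex.exp (-(z * k))) atTop (nhds 0) := by
    rw [tendsto_zero_iff_norm_tendsto_zero]
    have := (tendsto_rpow_mul_exp_neg_mul_atTop_nhds_zero 0 z.re hz)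
    simpa [hn] using this
  have t3 := ((t1.mul_const z⁻¹).add (t2.mul_const (z ^ 2)⁻¹)).neg
  rw [integral_Ioi_of_hasDerivAt_of_tendsto' (fun k _ => hder k) hint t3]
  simp

lemma aux_four (f : ℝ → ℂ) (hf : ContDiff ℝ (⊤ : ℕ∞) f) (hfc : HasCompactSupport f)
    (G : ℝ → ℂ) (hG : ∀ k : ℝ, G k = ∫ x : ℝ, Complex.exp (Complex.I * k * x) * f x) :
    Continuous G ∧ (∃ C, ∀ k, ‖G k‖ ≤ C) ∧ Integrable (fun k => k * ‖G k‖ ^ 2) := by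
  let φ : SchwartzMap ℝ ℂ := hfc.toSchwartzMap hf
  have hφ : ∀ x, φ x = f x := fun x => rfl
  let ψ : SchwartzMap ℝ ℂ := FourierTransform.fourier φ
  have hψ : ∀ k, G k = ψ (k * (-(2 * Real.pi)⁻¹)) := by
    intro k
    have : ψ (k * (-(2 * Real.pi)⁻¹)) =
        FourierTransform.fourier (φ : ℝ → ℂ) (k * (-(2 * Real.pi)⁻¹)) := by
      rw [← SchwartzMap.fourier_coe]
    rw [this, Real.fourier_real_eq_integral_exp_smul, hG]
    refine integral_congr_ae (Eventually.of_forall fun x => ?_)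
    simp only [smul_eq_mul, hφ]
    congr 2
    have := Real.pi_ne_zero
    push_cast
    field_simp
  have hcont : Continuous G := by
    rw [funext hψ]
    exact ψ.continuous.comp (by fun_prop)
  obtain ⟨C, hC⟩ : ∃ C, ∀ k, ‖G k‖ ≤ C := by
    obtain ⟨C, -, hC⟩ := ψ.decay 0 0
    refine ⟨C, fun k => ?_⟩
    rw [hψ]
    simpa using hC (k * (-(2 * Real.pi)⁻¹))
  refine ⟨hcont, ⟨C, hC⟩, ?_⟩
  have h1 := ψ.integrable_pow_mul volume 1
  have hne : (-(2 * Real.pi)⁻¹) ≠ 0 := by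
    have := Real.pi_pos
    simp [Real.pi_ne_zero]
  have h2 := ((h1.comp_mul_right' hne).const_mul (2 * Real.pi)).mul_const C
  refine h2.mono' (by apply Continuous.aestronglyMeasurable; fun_prop)
    (Eventually.of_forall fun k => ?_)
  rw [← hψ]
  have hp := Real.pi_pos
  simp only [pow_one, norm_mul, norm_neg, norm_inv, Real.norm_eq_abs, abs_of_pos hp, norm_pow,
    abs_norm, abs_two]
  have : 2 * Real.pi * (|k| * (2 * Real.pi)⁻¹ * ‖G k‖) * C = |k| * (‖G k‖ * C) := by
    field_simp
  rw [this, sq]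
  gcongr
  exact hC k

lemma aux_eps (f : ℝ → ℂ) (hfi : Integrable f)
    (G : ℝ → ℂ) (hG : ∀ k : ℝ, G k = ∫ x : ℝ, Complex.exp (Complex.I * k * x) * f x)
    (hGc : Continuous G) (C : ℝ) (hC : ∀ k, ‖G k‖ ≤ C) (ε : ℝ) (hε : 0 < ε) :
    ∫ x : ℝ, ∫ y : ℝ,
          (starRingEnd ℂ) (f x) * f y * (((x : ℂ) - (y : ℂ) - (ε : ℂ) * Complex.I) ^ 2)⁻¹ =
    - ∫ k in Set.Ioi (0:ℝ), (k:ℂ) * Complex.exp (-(ε * k)) * ((‖G k‖ : ℂ) ^ 2) := by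
  have hgi := aux_int ε hε
  have hnorm : ∀ s k x : ℝ, ‖Complex.exp (Complex.I * s * k * x)‖ ≤ 1 := by
    intro s k x
    rw [show Complex.I * s * k * x = ((s * k * x : ℝ) : ℂ) * Complex.I by
          push_cast; ring, Complex.norm_exp_ofReal_mul_I]
  have hin : ∀ x : ℝ, ∫ y : ℝ,
      (starRingEnd ℂ) (f x) * f y * (((x : ℂ) - (y : ℂ) - (ε : ℂ) * Complex.I) ^ 2)⁻¹ =
      - ((starRingEnd ℂ) (f x) * ∫ k in Set.Ioi (0:ℝ),
        ((k:ℂ) * Complex.exp (-(ε * k)) * G k) * Complex.exp (Complex.I * (-1 : ℝ) * k * x)) := by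
    intro x
    have hv : Integrable (fun k : ℝ => ((k:ℂ) * Complex.exp (-(ε * k))) *
        Complex.exp (Complex.I * (-1 : ℝ) * k * x)) (volume.restrict (Set.Ioi 0)) :=
      Integrable.mul_bdd (c := 1) hgi
        (by apply Continuous.aestronglyMeasurable; fun_prop)
        (Eventually.of_forall fun k => hnorm _ _ _)
    have hs := aux_swap (volume.restrict (Set.Ioi 0)) f _ 1 hfi hv
    have e1 : ∀ y : ℝ, (((x : ℂ) - (y : ℂ) - (ε : ℂ) * Complex.I) ^ 2)⁻¹ =
      - ∫ k in Set.Ioi (0:ℝ), ((k:ℂ) * Complex.exp (-(ε * k))) *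
        Complex.exp (Complex.I * (-1 : ℝ) * k * x) * Complex.exp (Complex.I * (1:ℝ) * k * y) := by
      intro y
      have hg := aux_gamma (ε + Complex.I * (x - y)) (by simpa using hε)
      have : (ε + Complex.I * (x - y)) ^ 2 = -(((x : ℂ) - (y : ℂ) - (ε : ℂ) * Complex.I) ^ 2) := by
        ring_nf; simp only [Complex.I_sq]; ring
      rw [this, inv_neg] at hg
      rw [← neg_eq_iff_eq_neg, ← hg]
      refine integral_congr_ae (Eventually.of_forall fun k => ?_)
      simp only [mul_assoc]
      rw [← Complex.exp_add, ← Complex.exp_add]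
      congr 2
      push_cast
      ring
    have e2 : ∀ y : ℝ, (starRingEnd ℂ) (f x) * f y *
        (((x : ℂ) - (y : ℂ) - (ε : ℂ) * Complex.I) ^ 2)⁻¹ = -(starRingEnd ℂ) (f x) *
        (f y * ∫ k in Set.Ioi (0:ℝ), ((k:ℂ) * Complex.exp (-(ε * k))) *
        Complex.exp (Complex.I * (-1 : ℝ) * k * x) * Complex.exp (Complex.I * (1:ℝ) * k * y)) := by
      intro y; rw [e1]; ring
    simp_rw [e2]
    rw [integral_const_mul, hs, neg_mul]
    congr 2
    refine integral_congr_ae (Eventually.of_forall fun k => ?_)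
    simp only [Complex.ofReal_one, mul_one, hG k]
    ring
  simp_rw [hin]
  rw [integral_neg]
  congr 1
  have hv : Integrable (fun k : ℝ => ((k:ℂ) * Complex.exp (-(ε * k))) * G k)
      (volume.restrict (Set.Ioi 0)) :=
    Integrable.mul_bdd (c := C) hgi hGc.aestronglyMeasurable (Eventually.of_forall fun k => hC k)
  have hfs : Integrable (fun x => (starRingEnd ℂ) (f x)) :=
    (Complex.conjLIE.toContinuousLinearEquiv.toContinuousLinearMap).integrable_comp hfi
  rw [aux_swap (volume.restrict (Set.Ioi 0)) _ _ (-1) hfs hv]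
  refine integral_congr_ae (Eventually.of_forall fun k => ?_)
  have : (∫ x : ℝ, Complex.exp (Complex.I * (-1:ℝ) * k * x) * (starRingEnd ℂ) (f x)) =
      (starRingEnd ℂ) (G k) := by
    rw [hG, ← integral_conj]
    refine integral_congr_ae (Eventually.of_forall fun x => ?_)
    simp [← Complex.exp_conj]
  simp only [this]
  rw [mul_assoc, Complex.mul_conj']

/-- Positivity of the horizon two-point function: for smooth compactly supported `f`,
`λ(f,f) = lim_{ε→0⁺} −(1/π) ∫∫ conj(f(x)) f(y) (x − y − iε)^{−2} dx dy` exists, is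
real, equals `∫_0^∞ 2k |f̂(k)|² dk`, and is nonnegative. -/
theorem stmt_15
    (f : ℝ → ℂ) (hf : ContDiff ℝ (⊤ : ℕ∞) f) (hfc : HasCompactSupport f)
    (fhat : ℝ → ℂ)
    (hfhat : ∀ k : ℝ, fhat k =
      (((2*Real.pi) ^ (-(1/2) : ℝ) : ℝ) : ℂ) * ∫ x : ℝ, Complex.exp (Complex.I * k * x) * f x) :
    Tendsto (fun ε : ℝ =>
        -(1/(Real.pi : ℂ)) * ∫ x : ℝ, ∫ y : ℝ,
          (starRingEnd ℂ) (f x) * f y * (((x : ℂ) - (y : ℂ) - (ε : ℂ) * Complex.I) ^ 2)⁻¹)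
      (nhdsWithin 0 (Set.Ioi 0))
      (nhds (((∫ k in Set.Ioi (0:ℝ), 2*k*‖fhat k‖^2 : ℝ) : ℂ))) ∧
    0 ≤ ∫ k in Set.Ioi (0:ℝ), 2*k*‖fhat k‖^2 := by
  have hp := Real.pi_pos
  constructor
  swap
  · refine setIntegral_nonneg measurableSet_Ioi fun k hk => ?_
    have : (0:ℝ) < k := hk
    positivity
  obtain ⟨G, hG⟩ : ∃ G : ℝ → ℂ, ∀ k : ℝ, G k = ∫ x : ℝ, Complex.exp (Complex.I * k * x) * f x :=
    ⟨_, fun _ => rfl⟩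
  obtain ⟨hGc, ⟨C, hC⟩, hGi⟩ := aux_four f hf hfc G hG
  have hfi : Integrable f := hf.continuous.integrable_of_hasCompactSupport hfc
  have key : ∀ k, 2 * k * ‖fhat k‖ ^ 2 = 1 / Real.pi * (k * ‖G k‖ ^ 2) := by
    intro k
    rw [hfhat, ← hG, norm_mul, mul_pow, Complex.norm_real, Real.norm_eq_abs, sq_abs,
      ← Real.rpow_natCast, ← Real.rpow_mul (by positivity)]
    norm_num
    rw [Real.rpow_neg_one]
    field_simp
  have hlim : Tendsto (fun ε : ℝ => ∫ k in Set.Ioi (0:ℝ),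
      (k:ℂ) * Complex.exp (-(ε * k)) * ((‖G k‖ : ℂ) ^ 2)) (nhdsWithin 0 (Set.Ioi 0))
      (nhds (∫ k in Set.Ioi (0:ℝ), ((k * ‖G k‖ ^ 2 : ℝ) : ℂ))) := by
    refine tendsto_integral_filter_of_dominated_convergence (fun k => ‖k * ‖G k‖ ^ 2‖) ?_ ?_
      hGi.norm.integrableOn ?_
    · refine Eventually.of_forall fun ε => ?_
      apply Continuous.aestronglyMeasurable
      fun_prop
    · filter_upwards [self_mem_nhdsWithin] with ε hε
      filter_upwards [ae_restrict_mem measurableSet_Ioi] with k hk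
      have hε' : (0:ℝ) < ε := hε
      have hk' : (0:ℝ) < k := hk
      have : ‖Complex.exp (-(ε * k))‖ ≤ 1 := by
        rw [Complex.norm_exp]
        simp
        positivity
      simp only [norm_mul, norm_pow, Complex.norm_real, norm_norm]
      gcongr
      exact mul_le_of_le_one_right (norm_nonneg _) this
    · refine Eventually.of_forall fun k => ?_
      have : Continuous fun ε : ℝ => (k:ℂ) * Complex.exp (-(ε * k)) * ((‖G k‖ : ℂ) ^ 2) := by
        fun_prop
      have h := (this.tendsto 0).mono_left (nhdsWithin_le_nhds (s := Set.Ioi 0))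
      simpa using h
  simp_rw [key]
  rw [integral_const_mul, Complex.ofReal_mul, ← integral_complex_ofReal]
  have h := hlim.const_mul ((1 / Real.pi : ℝ) : ℂ)
  refine h.congr' ?_
  filter_upwards [self_mem_nhdsWithin] with ε hε
  rw [aux_eps f hfi G hG hGc C hC ε hε]
  push_cast
  ring
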